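/- Let W be a 2-dimensional Coxeter group. Then for every g ∈ W with g ≠ id, the set T(g) has cardinality 1 or 2. -/

import Mathlib

namespace CoxeterPaper

open CoxeterSystem

attribute [local instance] Classical.propDecidable

variable {B : Type} [DecidableEq B] [Fintype B]
variable {W : Type} [Group W] {M : CoxeterMatrix B}

/-- The right descent set `T(g) = {s ∈ S : ℓ(gs) < ℓ(g)}`, as a set of indices. -/
def descentSet (cs : CoxeterSystem M W) (g : W) : Set B :=
  {i | cs.IsRightDescent g i}

/-- The subgroup `⟨T(g)⟩` generated by the right descent set of `g`. -/
def descSubgroup (cs : CoxeterSystem M W) (g : W) : Subgroup W :=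
  Subgroup.closure (cs.simple '' descentSet cs g)

/-- `w(g)`: the longest element of `⟨T(g)⟩` (defined via choice; for `g ≠ 1` the
subgroup `⟨T(g)⟩` is finite and has a unique longest element). -/
noncomputable def wg (cs : CoxeterSystem M W) (g : W) : W :=
  if h : ∃ w₀ ∈ descSubgroup cs g, ∀ u ∈ descSubgroup cs g, cs.length u ≤ cs.length w₀
  then h.choose else 1

/-- `Π(g) = g · w(g)`. -/
noncomputable def PiMap (cs : CoxeterSystem M W) (g : W) : W := g * wg cs g

/-- The standard language `𝓛 ⊆ S*`: the empty word is in `𝓛` (and it is the only word of `𝓛`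
representing the identity); a word `v` of length `n` representing `g ≠ 1` is in `𝓛` iff,
setting `k = ℓ(w(g))`, the prefix `v(n-k)` is in `𝓛` and `v(n-k+1, n)` represents `w(g)`. -/
inductive StdLang (cs : CoxeterSystem M W) : List B → Prop
  | nil : StdLang cs []
  | step (v : List B) (hne : cs.wordProd v ≠ 1)
      (hpre : StdLang cs (v.take (v.length - cs.length (wg cs (cs.wordProd v)))))
      (hsuf : cs.wordProd (v.drop (v.length - cs.length (wg cs (cs.wordProd v))))
        = wg cs (cs.wordProd v)) : StdLang cs v

/-- A Coxeter group is 2-dimensional if every triple of distinct generators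
generates an infinite subgroup. -/
def TwoDimensional (cs : CoxeterSystem M W) : Prop :=
  ∀ i j k : B, i ≠ j → i ≠ k → j ≠ k →
    Infinite (Subgroup.closure {cs.simple i, cs.simple j, cs.simple k} : Subgroup W)

/-- The wall of the reflection `ρ` separates `g` and `h`. -/
def Separates (cs : CoxeterSystem M W) (ρ g h : W) : Prop :=
  Xor' (cs.length (ρ * g) < cs.length g) (cs.length (ρ * h) < cs.length h)

/-- `h` is adjacent to the wall of the reflection `ρ`. -/
def AdjacentWall (cs : CoxeterSystem M W) (ρ h : W) : Prop :=
  ∃ i : B, ρ = h * cs.simple i * h⁻¹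

/-- The wall of `ρ'` separates `g` from the wall of `ρ`. -/
def SeparatesFromWall (cs : CoxeterSystem M W) (ρ' g ρ : W) : Prop :=
  ∀ h : W, AdjacentWall cs ρ h → Separates cs ρ' g h

/-- `𝓦(g)`: the set of walls (identified with their reflections) separating `g` from the
identity and not separated from `g` by any other wall. -/
def WallsNear (cs : CoxeterSystem M W) (g : W) : Set W :=
  {ρ | cs.IsReflection ρ ∧ cs.length (ρ * g) < cs.length g ∧
    ∀ ρ' : W, cs.IsReflection ρ' → ρ' ≠ ρ → ¬ SeparatesFromWall cs ρ' g ρ}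

section Exchange

lemma end_one_apply {α : Type*} (x : α) : (1 : Function.End α) x = x := rfl

lemma end_mul_apply {α : Type*} (f g : Function.End α) (x : α) : (f * g) x = f (g x) := rfl

variable {ι G : Type*} [Group G] {N : CoxeterMatrix ι} (cs : CoxeterSystem N G)

/-- The map `(t, ε) ↦ (sᵢ t sᵢ, ε + [t = sᵢ])` on `G × ℤ/2`. -/
noncomputable def signedConj (i : ι) : Function.End (G × ZMod 2) :=
  fun p ↦ (cs.simple i * p.1 * cs.simple i, p.2 + if p.1 = cs.simple i then 1 else 0)

lemma simple_mul_conj_pow (i j : ι) (n : ℕ) :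
    cs.simple j * (cs.simple i * cs.simple j) ^ n =
      ((cs.simple i * cs.simple j) ^ n)⁻¹ * cs.simple j := by
  have h : (cs.simple i * cs.simple j)⁻¹ = cs.simple j * cs.simple i := by simp
  rw [← inv_pow, h]
  induction n with
  | zero => simp
  | succ n ih => rw [pow_succ, ← mul_assoc, ih, pow_succ]; simp [mul_assoc]

lemma conj_pow_eq_simple_iff (i j : ι) (n : ℕ) (t : G) :
    (cs.simple i * cs.simple j) ^ n * t * ((cs.simple i * cs.simple j) ^ n)⁻¹ = cs.simple j ↔
      t = cs.simple j * (cs.simple i * cs.simple j) ^ (2 * n) := by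
  rw [two_mul, pow_add, ← mul_assoc, simple_mul_conj_pow, mul_inv_eq_iff_eq_mul, mul_assoc,
    eq_inv_mul_iff_mul_eq]

lemma conj_conj_pow_eq_simple_iff (i j : ι) (n : ℕ) (t : G) :
    cs.simple j * ((cs.simple i * cs.simple j) ^ n * t * ((cs.simple i * cs.simple j) ^ n)⁻¹) *
        cs.simple j = cs.simple i ↔
      t = cs.simple j * (cs.simple i * cs.simple j) ^ (2 * n + 1) := by
  have h : cs.simple j * (cs.simple i * cs.simple j) ^ (2 * n + 1) =
      ((cs.simple i * cs.simple j) ^ n)⁻¹ *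
        (cs.simple j * cs.simple i * cs.simple j * (cs.simple i * cs.simple j) ^ n) := by
    rw [two_mul, add_assoc, pow_add, pow_succ', ← mul_assoc, simple_mul_conj_pow]
    simp only [mul_assoc]
  rw [h, eq_inv_mul_iff_mul_eq, ← mul_inv_eq_iff_eq_mul]
  generalize (cs.simple i * cs.simple j) ^ n * t * ((cs.simple i * cs.simple j) ^ n)⁻¹ = y
  constructor <;> rintro e
  · simp [← e, mul_assoc]
  · simp [e, mul_assoc]

lemma signedConj_mul_pow_apply (i j : ι) (n : ℕ) (t : G) (ε : ZMod 2) :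
    ((signedConj cs i * signedConj cs j) ^ n : Function.End (G × ZMod 2)) (t, ε) =
      ((cs.simple i * cs.simple j) ^ n * t * ((cs.simple i * cs.simple j) ^ n)⁻¹,
        ε + ∑ k ∈ Finset.range (2 * n),
          if t = cs.simple j * (cs.simple i * cs.simple j) ^ k then 1 else 0) := by
  induction n with
  | zero => simp [end_one_apply]
  | succ n ih =>
    rw [pow_succ', end_mul_apply, ih, end_mul_apply]
    simp only [signedConj, conj_pow_eq_simple_iff, conj_conj_pow_eq_simple_iff]
    rw [show 2 * (n + 1) = 2 * n + 1 + 1 by ring, Finset.sum_range_succ, Finset.sum_range_succ,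
      pow_succ' _ n]
    refine Prod.ext ?_ ?_
    · simp [mul_assoc]
    · simp only [add_assoc]

lemma isLiftable_signedConj : N.IsLiftable (signedConj cs) := by
  intro i j
  funext ⟨t, ε⟩
  rw [signedConj_mul_pow_apply, two_mul, Finset.sum_range_add]
  simp [end_one_apply, pow_add, CharTwo.add_self_eq_zero]

/-- The action of a Coxeter group on `G × ℤ/2` lifting `signedConj`. -/
noncomputable def signedConjHom : G →* Function.End (G × ZMod 2) :=
  cs.lift ⟨signedConj cs, isLiftable_signedConj cs⟩

lemma signedConjHom_wordProd (ω : List ι) (t : G) (ε : ZMod 2) :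
    signedConjHom cs (cs.wordProd ω) (t, ε) =
      (cs.wordProd ω * t * (cs.wordProd ω)⁻¹, ε + (cs.rightInvSeq ω).count t) := by
  induction ω with
  | nil => simp [end_one_apply]
  | cons i ω ih =>
    rw [cs.wordProd_cons, map_mul, end_mul_apply, ih, signedConjHom,
      cs.lift_apply_simple (isLiftable_signedConj cs)]
    refine Prod.ext ?_ ?_
    · simp [signedConj, mul_assoc]
    · have h : (cs.wordProd ω * t * (cs.wordProd ω)⁻¹ = cs.simple i) ↔
          ((cs.wordProd ω)⁻¹ * cs.simple i * cs.wordProd ω = t) := by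
        rw [mul_inv_eq_iff_eq_mul, mul_assoc, inv_mul_eq_iff_eq_mul, eq_comm]
      simp only [signedConj, CoxeterSystem.rightInvSeq, List.count_cons, h, beq_iff_eq]
      push_cast
      ring

/-- The exchange condition, in terms of the right inversion sequence. -/
lemma simple_mem_rightInvSeq_of_isRightDescent (ω : List ι) (i : ι)
    (h : cs.IsRightDescent (cs.wordProd ω) i) : cs.simple i ∈ cs.rightInvSeq ω := by
  by_contra hmem
  obtain ⟨ω', hω', hprod⟩ := cs.exists_isReduced (cs.wordProd ω * cs.simple i)
  have hnot : cs.simple i ∉ cs.rightInvSeq ω' := by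
    intro hmem'
    have := (cs.isRightInversion_of_mem_rightInvSeq hω' hmem').2
    rw [← hprod, cs.simple_mul_simple_cancel_right] at this
    exact lt_asymm h this
  have e := signedConjHom_wordProd cs ω' (cs.simple i) 0
  rw [← hprod, map_mul, end_mul_apply, signedConjHom,
    cs.lift_apply_simple (isLiftable_signedConj cs)] at e
  have e' := signedConjHom_wordProd cs ω (cs.simple i) 1
  rw [signedConjHom] at e'
  simp only [signedConj, cs.simple_mul_simple_cancel_right, if_true, zero_add] at e
  simp [e', List.count_eq_zero_of_not_mem hmem, List.count_eq_zero_of_not_mem hnot] at e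

/-- The exchange condition. -/
lemma exists_wordProd_mul_simple_eq_eraseIdx (ω : List ι) (i : ι)
    (h : cs.IsRightDescent (cs.wordProd ω) i) :
    ∃ k < ω.length, cs.wordProd ω * cs.simple i = cs.wordProd (ω.eraseIdx k) := by
  obtain ⟨k, hk, hki⟩ :=
    List.getElem_of_mem (simple_mem_rightInvSeq_of_isRightDescent cs ω i h)
  refine ⟨k, by simpa using hk, ?_⟩
  rw [← cs.wordProd_mul_getD_rightInvSeq, List.getD_eq_getElem _ _ hk, hki]

lemma exists_word_length_add_length_mul_le {J : Set ι} {g : G}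
    (hJ : ∀ i ∈ J, cs.IsRightDescent g i) (n : ℕ) (ω : List ι) (hn : ω.length ≤ n)
    (hω : ∀ i ∈ ω, i ∈ J) :
    ∃ ω' : List ι, ω'.length ≤ ω.length ∧ (∀ i ∈ ω', i ∈ J) ∧
      cs.wordProd ω' = cs.wordProd ω ∧
      ω'.length + cs.length (g * cs.wordProd ω) ≤ cs.length g := by
  induction n generalizing ω with
  | zero =>
    obtain rfl : ω = [] := List.length_eq_zero_iff.mp (by omega)
    exact ⟨[], by simp⟩
  | succ n ih =>
    rcases ω with _ | ⟨i, ω⟩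
    · exact ⟨[], by simp⟩
    have hi : i ∈ J := hω i (by simp)
    obtain ⟨v, hvl, hvJ, hvp, hvg⟩ := ih ω (by simpa using hn)
      fun j hj ↦ hω j (List.mem_cons_of_mem _ hj)
    obtain ⟨x, hx, hxp⟩ := cs.exists_isReduced (g * cs.wordProd v)
    have hg : cs.wordProd (x ++ v.reverse) = g := by
      rw [cs.wordProd_append, cs.wordProd_reverse, ← hxp, mul_inv_cancel_right]
    obtain ⟨k, hk, hkp⟩ :=
      exists_wordProd_mul_simple_eq_eraseIdx cs (x ++ v.reverse) i (hg.symm ▸ hJ i hi)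
    rw [hg] at hkp
    rw [List.length_append, List.length_reverse] at hk
    have hxl : x.length = cs.length (g * cs.wordProd ω) := by rw [← hvp, hxp, hx.eq]
    simp only [List.length_cons] at hn ⊢
    rcases lt_or_ge k x.length with hkx | hkx
    · refine ⟨i :: v, by simpa, ?_, by rw [cs.wordProd_cons, cs.wordProd_cons, hvp], ?_⟩
      · simpa [hi] using hvJ
      · rw [List.eraseIdx_append_of_lt_length hkx, cs.wordProd_append, cs.wordProd_reverse,
          eq_mul_inv_iff_mul_eq, hvp, mul_assoc, ← cs.wordProd_cons] at hkp
        have h1 := cs.length_wordProd_le (x.eraseIdx k)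
        rw [← hkp, List.length_eraseIdx_of_lt hkx] at h1
        simp only [List.length_cons]
        omega
    · rw [List.eraseIdx_append_of_length_le hkx, cs.wordProd_append, ← hxp, mul_assoc,
        mul_right_inj, ← inv_mul_eq_iff_eq_mul, ← inv_inj, mul_inv_rev, inv_inv,
        cs.inv_simple, ← cs.wordProd_reverse, hvp, ← cs.wordProd_cons] at hkp
      have hlen : (v.reverse.eraseIdx (k - x.length)).reverse.length + 1 = v.length := by
        rw [List.length_reverse, List.length_eraseIdx_of_lt (by simp; omega), List.length_reverse]
        omega
      obtain ⟨u, hul, huJ, hup, hug⟩ := ih (v.reverse.eraseIdx (k - x.length)).reverse (by omega)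
        fun j hj ↦ hvJ j (List.mem_reverse.mp (List.mem_of_mem_eraseIdx (List.mem_reverse.mp hj)))
      rw [← hkp] at hup hug
      exact ⟨u, by omega, huJ, hup, hug⟩

lemma exists_wordProd_eq_of_mem_closure {J : Set ι} {w : G}
    (hw : w ∈ Subgroup.closure (cs.simple '' J)) :
    ∃ ω : List ι, (∀ i ∈ ω, i ∈ J) ∧ cs.wordProd ω = w := by
  induction hw using Subgroup.closure_induction with
  | mem x hx =>
    obtain ⟨i, hi, rfl⟩ := hx
    exact ⟨[i], by simpa using hi, by simp⟩
  | one => exact ⟨[], by simp⟩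
  | mul x y _ _ hx hy =>
    obtain ⟨u, hu, rfl⟩ := hx
    obtain ⟨v, hv, rfl⟩ := hy
    exact ⟨u ++ v, fun i hi ↦ (List.mem_append.mp hi).elim (hu i) (hv i), cs.wordProd_append u v⟩
  | inv x _ hx =>
    obtain ⟨u, hu, rfl⟩ := hx
    exact ⟨u.reverse, by simpa using hu, cs.wordProd_reverse u⟩

/-- A standard subgroup generated by right descents of a single element is finite. -/
lemma finite_closure_of_isRightDescent [Finite ι] {J : Set ι} {g : G}
    (hJ : ∀ i ∈ J, cs.IsRightDescent g i) :
    Finite (Subgroup.closure (cs.simple '' J)) := by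
  refine Set.Finite.subset ((List.finite_length_le ι (cs.length g)).image cs.wordProd) ?_
  intro w hw
  obtain ⟨ω, hω, rfl⟩ := exists_wordProd_eq_of_mem_closure cs hw
  obtain ⟨v, -, -, hv, hlen⟩ :=
    exists_word_length_add_length_mul_le cs hJ ω.length ω le_rfl hω
  exact ⟨v, by show v.length ≤ cs.length g; omega, hv⟩

end Exchange

/-- In a 2-dimensional Coxeter group, `|T(g)| ∈ {1, 2}` for every `g ≠ 1`. -/
theorem descentSet_card_le_two
    (cs : CoxeterSystem M W) (h2 : TwoDimensional cs) (g : W) (hg : g ≠ 1) :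
    (descentSet cs g).ncard = 1 ∨ (descentSet cs g).ncard = 2 := by
  have hne : (descentSet cs g).ncard ≠ 0 := by
    exact ((Set.ncard_pos (Set.toFinite _)).mpr (cs.exists_rightDescent_of_ne_one hg)).ne'
  have hle : (descentSet cs g).ncard ≤ 2 := by
    by_contra! hlt
    obtain ⟨i, hi, j, hj, k, hk, hij, hik, hjk⟩ := (Set.two_lt_ncard (Set.toFinite _)).mp hlt
    have hfin := finite_closure_of_isRightDescent cs (J := {i, j, k}) (g := g) (by
      rintro l (rfl | rfl | rfl) <;> assumption)
    rw [Set.image_insert_eq, Set.image_pair] at hfin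
    exact (h2 i j k hij hik hjk).not_finite hfin
  omega

end CoxeterPaper
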